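/- arXiv:2209.10322 — 4 statements merged into one kernel-verified Lean document; each statement's English description precedes it below -/
import Mathlib

section
/- For any three sets P₁, P₂, P₃ of finite words over an alphabet Σ, the merge operation is associative: (P₁ ⋈ P₂) ⋈ P₃ = P₁ ⋈ (P₂ ⋈ P₃). -/
/-- The merge of two sets of words:
`P ⋈ Q = {p ∈ P : ∃ q ∈ Q, q ≼ p} ∪ {q ∈ Q : ∃ p ∈ P, p ≼ q}`,
where `≼` is the (not necessarily proper) prefix relation. -/
def merge {α : Type*} (P Q : Set (List α)) : Set (List α) :=
  {p | p ∈ P ∧ ∃ q ∈ Q, q <+: p} ∪ {q | q ∈ Q ∧ ∃ p ∈ P, p <+: q}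

theorem mem_merge_iff {α : Type*} {P Q : Set (List α)} {w : List α} :
    w ∈ merge P Q ↔ (w ∈ P ∨ w ∈ Q) ∧ (∃ p ∈ P, p <+: w) ∧ ∃ q ∈ Q, q <+: w := by
  constructor
  · rintro (⟨hw, h⟩ | ⟨hw, h⟩)
    · exact ⟨Or.inl hw, ⟨w, hw, List.prefix_rfl⟩, h⟩
    · exact ⟨Or.inr hw, h, ⟨w, hw, List.prefix_rfl⟩⟩
  · rintro ⟨hw | hw, hp, hq⟩
    · exact Or.inl ⟨hw, hq⟩
    · exact Or.inr ⟨hw, hp⟩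

theorem exists_mem_merge_prefix_iff {α : Type*} {P Q : Set (List α)} {w : List α} :
    (∃ v ∈ merge P Q, v <+: w) ↔ (∃ p ∈ P, p <+: w) ∧ ∃ q ∈ Q, q <+: w := by
  constructor
  · rintro ⟨v, hv, hvw⟩
    obtain ⟨-, ⟨p, hp, hpv⟩, q, hq, hqv⟩ := mem_merge_iff.mp hv
    exact ⟨⟨p, hp, hpv.trans hvw⟩, q, hq, hqv.trans hvw⟩
  · rintro ⟨⟨p, hp, hpw⟩, q, hq, hqw⟩
    rcases List.prefix_or_prefix_of_prefix hpw hqw with h | h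
    · exact ⟨q, Or.inr ⟨hq, p, hp, h⟩, hqw⟩
    · exact ⟨p, Or.inl ⟨hp, q, hq, h⟩, hpw⟩

/-- The merge operation on sets of finite words is associative. -/
theorem merge_assoc {α : Type*} (P₁ P₂ P₃ : Set (List α)) :
    merge (merge P₁ P₂) P₃ = merge P₁ (merge P₂ P₃) := by
  ext w
  rw [mem_merge_iff (Q := P₃), mem_merge_iff (P := P₁) (Q := merge P₂ P₃),
    exists_mem_merge_prefix_iff, exists_mem_merge_prefix_iff, mem_merge_iff, mem_merge_iff]
  generalize (∃ p ∈ P₁, p <+: w) = a, (∃ p ∈ P₂, p <+: w) = b, (∃ p ∈ P₃, p <+: w) = c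
  tauto
end

section
/- Let A be a two-player game arena, R ⊆ Pos a set of positions, σ a strategy for Attacker, and v a position. Then σ is winning for the reachability game (A, R) from v (i.e., every play consistent with σ starting at v visits a position of R) if and only if there exists a witness of σ from v, i.e., a finite prefix S of the s-tree S^σ_v such that every leaf of S ends in a position of R. -/
/-- Synchronized concatenation, lifted to sets of words: `π ⊙ π'` is defined when the
last letter of `π` equals the first letter of `π'` and concatenates `π` with the tail of `π'`. -/
def sconcat {α : Type*} (P Q : Set (List α)) : Set (List α) :=
  {w | ∃ p ∈ P, ∃ q ∈ Q, p.getLast? = q.head? ∧ w = p ++ q.tail}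

/-- An s-tree over an alphabet `α`: a nonempty set of nonempty words, closed under
nonempty prefixes, all words having the same first letter (the root). -/
def IsSTree {α : Type*} (S : Set (List α)) : Prop :=
  S.Nonempty ∧ (∀ w ∈ S, w ≠ []) ∧
  (∀ w ∈ S, ∀ w' : List α, w' <+: w → w' ≠ [] → w' ∈ S) ∧
  (∃ a, ∀ w ∈ S, w.head? = some a)

/-- A leaf of an s-tree: a word with no proper extension in the tree. -/
def IsLeafOf {α : Type*} (S : Set (List α)) (w : List α) : Prop :=
  w ∈ S ∧ ∀ w' ∈ S, w <+: w' → w' = w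

/-- The children of `w` in `S`: its minimal proper extensions in `S`. -/
def childrenOf {α : Type*} (S : Set (List α)) (w : List α) : Set (List α) :=
  {w' | w' ∈ S ∧ w <+: w' ∧ w' ≠ w ∧
    ∀ w'' ∈ S, w <+: w'' → w'' <+: w' → w'' = w ∨ w'' = w'}

/-- `S'` is a prefix of the s-tree `S`: `S'` is an s-tree with the same root,
`S' ⊆ S`, and every non-leaf of `S'` has the same children in `S'` as in `S`. -/
def TreePrefix {α : Type*} (S' S : Set (List α)) : Prop :=
  IsSTree S' ∧ (∃ a, [a] ∈ S' ∧ [a] ∈ S) ∧ S' ⊆ S ∧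
  ∀ w ∈ S', ¬ IsLeafOf S' w → childrenOf S' w = childrenOf S w

/-! ### Transition systems and attack trees -/

/-- A transition system over propositions `π` with states `σ`. -/
structure TSys (σ π : Type*) where
  step : σ → σ → Prop
  val : σ → Set π

/-- A path of a transition system: a nonempty finite sequence of states related by `step`. -/
def IsTPath {σ π : Type*} (T : TSys σ π) (w : List σ) : Prop :=
  w ≠ [] ∧ List.Chain' T.step w

/-- Attack trees: a leaf is a Boolean formula, identified with the set of states where
it holds; inner nodes are `OR`, `SAND` and `AND` operators. -/
inductive ATree (σ : Type*) where
  | leaf (F : Set σ)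
  | or (t₁ t₂ : ATree σ)
  | sand (t₁ t₂ : ATree σ)
  | and (t₁ t₂ : ATree σ)

/-- The number of leaves of an attack tree. -/
def numLeaves {σ : Type*} : ATree σ → ℕ
  | .leaf _ => 1
  | .or t₁ t₂ => numLeaves t₁ + numLeaves t₂
  | .sand t₁ t₂ => numLeaves t₁ + numLeaves t₂
  | .and t₁ t₂ => numLeaves t₁ + numLeaves t₂

/-- The path semantics of an attack tree over a transition system. -/
def pathSem {σ π : Type*} (T : TSys σ π) : ATree σ → Set (List σ)
  | .leaf F => {w | IsTPath T w ∧ ∃ s ∈ F, w.getLast? = some s}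
  | .or t₁ t₂ => pathSem T t₁ ∪ pathSem T t₂
  | .sand t₁ t₂ => sconcat (pathSem T t₁) (pathSem T t₂)
  | .and t₁ t₂ => merge (pathSem T t₁) (pathSem T t₂)

/-! ### Two-player game arenas -/

/-- A two-player concurrent game arena: a total transition function on positions given
joint actions of the two players, and a valuation of positions by atomic propositions. -/
structure Arena (Pos Act₁ Act₂ Prp : Type*) where
  delta : Pos → Act₁ × Act₂ → Pos
  val : Pos → Set Prp

variable {Pos Act₁ Act₂ Prp : Type*}

/-- A play: an infinite sequence of positions, each next one reached by some joint action. -/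
def IsPlay (A : Arena Pos Act₁ Act₂ Prp) (ρ : ℕ → Pos) : Prop :=
  ∀ i : ℕ, ∃ a : Act₁ × Act₂, ρ (i + 1) = A.delta (ρ i) a

/-- The prefix of length `n` of a play. -/
def playPrefix (ρ : ℕ → Pos) (n : ℕ) : List Pos :=
  (List.range n).map ρ

/-- Consistency of a history with a strategy `σ` of the player whose actions are extracted
from joint actions by `proj` (`Prod.fst` for Player 1/Attacker, `Prod.snd` for Player 2). -/
def ConsistHist {Act : Type*} (A : Arena Pos Act₁ Act₂ Prp) (proj : Act₁ × Act₂ → Act)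
    (σ : List Pos → Act) (w : List Pos) : Prop :=
  ∀ (j : ℕ) (h : j + 1 < w.length),
    ∃ a : Act₁ × Act₂,
      A.delta (w[j]'(Nat.lt_of_succ_lt h)) a = w[j + 1]'h ∧ proj a = σ (w.take (j + 1))

/-- A play is consistent with a strategy if all its nonempty finite prefixes are. -/
def ConsistPlay {Act : Type*} (A : Arena Pos Act₁ Act₂ Prp) (proj : Act₁ × Act₂ → Act)
    (σ : List Pos → Act) (ρ : ℕ → Pos) : Prop :=
  ∀ n : ℕ, ConsistHist A proj σ (playPrefix ρ n)

/-- A history: a nonempty finite prefix of a play. -/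
def IsHist (A : Arena Pos Act₁ Act₂ Prp) (w : List Pos) : Prop :=
  ∃ ρ, IsPlay A ρ ∧ ∃ n, 1 ≤ n ∧ w = playPrefix ρ n

/-- `Hist A v`: the histories starting at position `v`. -/
def Hist (A : Arena Pos Act₁ Act₂ Prp) (v : Pos) : Set (List Pos) :=
  {w | ∃ ρ, IsPlay A ρ ∧ ρ 0 = v ∧ ∃ n, 1 ≤ n ∧ w = playPrefix ρ n}

/-- `Prefixes(Out(σ))`: nonempty finite prefixes of plays consistent with `σ`. -/
def PrefixesOut {Act : Type*} (A : Arena Pos Act₁ Act₂ Prp) (proj : Act₁ × Act₂ → Act)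
    (σ : List Pos → Act) : Set (List Pos) :=
  {w | ∃ ρ, IsPlay A ρ ∧ ConsistPlay A proj σ ρ ∧ ∃ n, 1 ≤ n ∧ w = playPrefix ρ n}

/-- The s-tree associated with a strategy `σ` from position `v`:
`S^σ_v = Prefixes(Out(σ)) ∩ Hist(A, v)`. -/
def STree {Act : Type*} (A : Arena Pos Act₁ Act₂ Prp) (proj : Act₁ × Act₂ → Act)
    (σ : List Pos → Act) (v : Pos) : Set (List Pos) :=
  PrefixesOut A proj σ ∩ Hist A v

/-- The transition system induced by a game arena: `(v, v')` is a transition iff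
`δ(v, a) = v'` for some joint action `a`. -/
def arenaTS (A : Arena Pos Act₁ Act₂ Prp) : TSys Pos Prp :=
  ⟨fun v v' => ∃ a : Act₁ × Act₂, A.delta v a = v', A.val⟩

/-- An Attacker strategy is winning for the reachability game `(A, R)` from `v` if every
play consistent with it starting at `v` visits a position of `R`. -/
def WinningFrom (A : Arena Pos Act₁ Act₂ Prp) (σ : List Pos → Act₁) (v : Pos)
    (R : Set Pos) : Prop :=
  ∀ ρ : ℕ → Pos, IsPlay A ρ → ConsistPlay A Prod.fst σ ρ → ρ 0 = v → ∃ i, ρ i ∈ R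

/-- A witness of an Attacker strategy `σ` from `v` for the reachability set `R`:
a finite prefix of `S^σ_v` all of whose leaves end in a position of `R`. -/
def Witness (A : Arena Pos Act₁ Act₂ Prp) (σ : List Pos → Act₁) (v : Pos) (R : Set Pos)
    (S : Set (List Pos)) : Prop :=
  S.Finite ∧ TreePrefix S (STree A Prod.fst σ v) ∧
  ∀ w, IsLeafOf S w → ∃ p ∈ R, w.getLast? = some p

/-- An s-tree over `Pos` is well-formed if it is a prefix of `S^σ_v` for some Attacker
strategy `σ` and position `v`. -/
def WellFormed (A : Arena Pos Act₁ Act₂ Prp) (S : Set (List Pos)) : Prop :=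
  ∃ (σ : List Pos → Act₁) (v : Pos), TreePrefix S (STree A Prod.fst σ v)

/-- The strategy semantics of an attack tree `t` over the arena `A`: the set of all
well-formed `t`-s-trees, i.e. well-formed finite s-trees all of whose leaves belong to
the path semantics of `t` over the transition system induced by `A`. -/
def stratSem (A : Arena Pos Act₁ Act₂ Prp) (t : ATree Pos) : Set (Set (List Pos)) :=
  {S | WellFormed A S ∧ S.Finite ∧ IsSTree S ∧
    ∀ w, IsLeafOf S w → w ∈ pathSem (arenaTS A) t}

@[simp]
theorem length_playPrefix (ρ : ℕ → Pos) (n : ℕ) : (playPrefix ρ n).length = n := by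
  simp [playPrefix]

theorem playPrefix_succ (ρ : ℕ → Pos) (n : ℕ) :
    playPrefix ρ (n + 1) = playPrefix ρ n ++ [ρ n] := by
  simp [playPrefix, List.range_succ]

@[simp]
theorem playPrefix_one (ρ : ℕ → Pos) : playPrefix ρ 1 = [ρ 0] := by
  simp [playPrefix, List.range_succ]

theorem mem_playPrefix {ρ : ℕ → Pos} {n : ℕ} {x : Pos} :
    x ∈ playPrefix ρ n ↔ ∃ i < n, ρ i = x := by
  simp [playPrefix]

theorem take_playPrefix (ρ : ℕ → Pos) {m n : ℕ} (h : m ≤ n) :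
    (playPrefix ρ n).take m = playPrefix ρ m := by
  simp [playPrefix, ← List.map_take, List.take_range, h]

theorem eq_playPrefix_of_isPrefix {ρ : ℕ → Pos} {n : ℕ} {w : List Pos}
    (h : w <+: playPrefix ρ n) : w.length ≤ n ∧ w = playPrefix ρ w.length := by
  have hl : w.length ≤ n := by simpa using h.length_le
  refine ⟨hl, ?_⟩
  rw [← take_playPrefix ρ hl]
  exact List.prefix_iff_eq_take.mp h

theorem head?_playPrefix (ρ : ℕ → Pos) {n : ℕ} (h : 1 ≤ n) :
    (playPrefix ρ n).head? = some (ρ 0) := by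
  obtain ⟨m, rfl⟩ := Nat.exists_eq_add_of_le' h
  simp [playPrefix, List.range_succ_eq_map]

/-- Every rule that reads the past generates an infinite sequence from a given start. -/
theorem exists_seq_playPrefix (next : List Pos → Pos) (v : Pos) :
    ∃ ρ : ℕ → Pos, ρ 0 = v ∧ ∀ n, ρ (n + 1) = next (playPrefix ρ (n + 1)) := by
  let f : ℕ → List Pos := fun n => Nat.rec [v] (fun _ w => w ++ [next w]) n
  let ρ : ℕ → Pos := fun n => Nat.casesOn n v fun m => next (f m)
  have hf : ∀ n, f n = playPrefix ρ (n + 1) := by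
    intro n
    induction n with
    | zero => simp [f, ρ]
    | succ n ih =>
      rw [playPrefix_succ, ← ih]
  exact ⟨ρ, rfl, fun n => by rw [← hf]⟩

theorem consistPlay_iff {Act : Type*} {A : Arena Pos Act₁ Act₂ Prp}
    {proj : Act₁ × Act₂ → Act} {σ : List Pos → Act} {ρ : ℕ → Pos} :
    ConsistPlay A proj σ ρ ↔
      ∀ j, ∃ a, A.delta (ρ j) a = ρ (j + 1) ∧ proj a = σ (playPrefix ρ (j + 1)) := by
  constructor
  · intro h j
    obtain ⟨a, ha, hσ⟩ := h (j + 2) j (by simp)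
    rw [take_playPrefix ρ (by omega)] at hσ
    exact ⟨a, by simpa [playPrefix] using ha, hσ⟩
  · intro h n j hj
    obtain ⟨a, ha, hσ⟩ := h j
    rw [length_playPrefix] at hj
    rw [take_playPrefix ρ (by omega)]
    exact ⟨a, by simpa [playPrefix] using ha, hσ⟩

theorem ConsistPlay.isPlay {Act : Type*} {A : Arena Pos Act₁ Act₂ Prp}
    {proj : Act₁ × Act₂ → Act} {σ : List Pos → Act} {ρ : ℕ → Pos}
    (h : ConsistPlay A proj σ ρ) : IsPlay A ρ := fun i =>
  let ⟨a, ha, _⟩ := consistPlay_iff.mp h i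
  ⟨a, ha.symm⟩

theorem mem_STree {Act : Type*} {A : Arena Pos Act₁ Act₂ Prp}
    {proj : Act₁ × Act₂ → Act} {σ : List Pos → Act} {v : Pos} {w : List Pos} :
    w ∈ STree A proj σ v ↔
      ∃ ρ, ConsistPlay A proj σ ρ ∧ ρ 0 = v ∧ ∃ n, 1 ≤ n ∧ w = playPrefix ρ n := by
  constructor
  · rintro ⟨⟨ρ, -, hc, n, hn, rfl⟩, ρ', -, h0, n', hn', he⟩
    refine ⟨ρ, hc, ?_, n, hn, rfl⟩
    have := congrArg List.head? he
    rw [head?_playPrefix _ hn, head?_playPrefix _ hn', h0] at this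
    exact Option.some.inj this
  · rintro ⟨ρ, hc, h0, n, hn, rfl⟩
    exact ⟨⟨ρ, hc.isPlay, hc, n, hn, rfl⟩, ρ, hc.isPlay, h0, n, hn, rfl⟩

theorem mem_STree_of_isPrefix {Act : Type*} {A : Arena Pos Act₁ Act₂ Prp}
    {proj : Act₁ × Act₂ → Act} {σ : List Pos → Act} {v : Pos} {w w' : List Pos}
    (h : w ∈ STree A proj σ v) (hp : w' <+: w) (hne : w' ≠ []) : w' ∈ STree A proj σ v := by
  obtain ⟨ρ, hc, h0, n, -, rfl⟩ := mem_STree.mp h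
  exact mem_STree.mpr ⟨ρ, hc, h0, _, List.length_pos_iff.mpr hne,
    (eq_playPrefix_of_isPrefix hp).2⟩

theorem exists_consistPlay [Nonempty Act₂] (A : Arena Pos Act₁ Act₂ Prp)
    (σ : List Pos → Act₁) (v : Pos) :
    ∃ ρ, ConsistPlay A Prod.fst σ ρ ∧ ρ 0 = v := by
  obtain ⟨b⟩ := ‹Nonempty Act₂›
  obtain ⟨ρ, h0, hρ⟩ := exists_seq_playPrefix (fun w => A.delta (w.getLastD v) (σ w, b)) v
  refine ⟨ρ, consistPlay_iff.mpr fun j => ⟨(σ (playPrefix ρ (j + 1)), b), ?_, rfl⟩, h0⟩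
  rw [hρ j]
  simp [playPrefix_succ]

/-- The branch of a sequence through a finite prefix of an s-tree reaches a leaf. -/
theorem TreePrefix.exists_isLeafOf_playPrefix {S T : Set (List Pos)} (h : TreePrefix S T)
    (hfin : S.Finite) {ρ : ℕ → Pos} (hρ : ∀ n, 1 ≤ n → playPrefix ρ n ∈ T)
    (h1 : playPrefix ρ 1 ∈ S) : ∃ n, 1 ≤ n ∧ IsLeafOf S (playPrefix ρ n) := by
  obtain ⟨-, -, -, hchild⟩ := h
  by_contra! hno
  have hall : ∀ n, playPrefix ρ (n + 1) ∈ S := by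
    intro n
    induction n with
    | zero => exact h1
    | succ n ih =>
      have hmem : playPrefix ρ (n + 1 + 1) ∈ childrenOf T (playPrefix ρ (n + 1)) := by
        refine ⟨hρ _ (by omega), ⟨[ρ (n + 1)], (playPrefix_succ ρ (n + 1)).symm⟩, ?_, ?_⟩
        · intro he
          simpa using congrArg List.length he
        · intro w _ hw hw'
          obtain ⟨hle, he⟩ := eq_playPrefix_of_isPrefix hw'
          have hge : n + 1 ≤ w.length := by simpa using hw.length_le
          obtain hl | hl : w.length = n + 1 ∨ w.length = n + 1 + 1 := by omega
          · left; rw [he, hl]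
          · right; rw [he, hl]
      rw [← hchild _ ih (hno _ (by omega))] at hmem
      exact hmem.1
  refine Set.infinite_of_injective_forall_mem (f := fun n => playPrefix ρ (n + 1)) ?_ hall hfin
  intro m n hmn
  simpa using congrArg List.length hmn

/-- Kőnig's lemma for prefix-closed sets of words over a finite alphabet. -/
theorem exists_seq_playPrefix_mem [Finite Pos] {S : Set (List Pos)} {v : Pos}
    (hcl : ∀ w ∈ S, ∀ w' : List Pos, w' <+: w → w' ≠ [] → w' ∈ S)
    (hhead : ∀ w ∈ S, w.head? = some v) (hinf : S.Infinite) :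
    ∃ ρ : ℕ → Pos, ρ 0 = v ∧ ∀ n, playPrefix ρ (n + 1) ∈ S := by
  let Big : List Pos → Prop := fun w => {w' | w' ∈ S ∧ w <+: w'}.Infinite
  have hstep : ∀ w, ∃ x, Big w → Big (w ++ [x]) := by
    intro w
    by_contra! hno
    have hw : Big w := (hno v).1
    refine hw (((Set.finite_singleton w).union
      (Set.finite_iUnion fun x => Set.not_infinite.mp (hno x).2)).subset ?_)
    rintro w' ⟨hw', t, rfl⟩
    cases t with
    | nil => simp
    | cons x t =>
      exact Or.inr (Set.mem_iUnion.mpr ⟨x, hw', t, by simp⟩)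
  choose next hnext using hstep
  obtain ⟨ρ, h0, hρ⟩ := exists_seq_playPrefix next v
  have hbig : ∀ n, Big (playPrefix ρ (n + 1)) := by
    intro n
    induction n with
    | zero =>
      refine hinf.mono fun w hw => ⟨hw, ?_⟩
      have := hhead w hw
      cases w with
      | nil => simp at this
      | cons x t =>
        obtain rfl : x = v := by simpa using this
        simp [h0]
    | succ n ih =>
      rw [playPrefix_succ, hρ]
      exact hnext _ ih
  refine ⟨ρ, h0, fun n => ?_⟩
  obtain ⟨w, hw, hp⟩ := (hbig n).nonempty
  exact hcl w hw _ hp (by simp [playPrefix_succ])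

/-- The subtree of words no proper prefix of which has met `R`. -/
def cutAt (R : Set Pos) (T : Set (List Pos)) : Set (List Pos) :=
  {w | w ∈ T ∧ ∀ x ∈ w.dropLast, x ∉ R}

theorem treePrefix_cutAt {T : Set (List Pos)} (hT : IsSTree T) (R : Set Pos) :
    TreePrefix (cutAt R T) T := by
  obtain ⟨⟨w₀, hw₀⟩, hne, hcl, a, ha⟩ := hT
  have hroot : [a] ∈ T := by
    refine hcl w₀ hw₀ _ ?_ (by simp)
    have := ha w₀ hw₀
    cases w₀ with
    | nil => simp at this
    | cons x t =>
      obtain rfl : x = a := by simpa using this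
      simp
  have hroot' : [a] ∈ cutAt R T := ⟨hroot, by simp⟩
  have hcl' : ∀ w ∈ cutAt R T, ∀ w' : List Pos, w' <+: w → w' ≠ [] → w' ∈ cutAt R T := by
    rintro w ⟨hw, hR⟩ w' hp h
    refine ⟨hcl w hw w' hp h, fun x hx => hR x ?_⟩
    obtain ⟨t, rfl⟩ := hp
    rcases eq_or_ne t [] with rfl | ht
    · simpa using hx
    · rw [List.dropLast_append_of_ne_nil ht]
      exact List.mem_append_left _ (List.dropLast_subset _ hx)
  refine ⟨⟨⟨_, hroot'⟩, fun w hw => hne w hw.1, hcl', a, fun w hw => ha w hw.1⟩,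
    ⟨a, hroot', hroot⟩, fun w hw => hw.1, ?_⟩
  intro w hw hleaf
  have hwR : ∀ x ∈ w, x ∉ R := by
    simp only [IsLeafOf, hw, true_and, not_forall] at hleaf
    obtain ⟨w', hw', ⟨t, rfl⟩, hneq⟩ := hleaf
    have ht : t ≠ [] := by rintro rfl; simp at hneq
    intro x hx
    refine hw'.2 x ?_
    rw [List.dropLast_append_of_ne_nil ht]
    exact List.mem_append_left _ hx
  ext w'
  constructor
  · rintro ⟨hw', hp, hneq, hmin⟩
    exact ⟨hw'.1, hp, hneq, fun u hu hwu huw =>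
      hmin u (hcl' w' hw' u huw (hne u hu)) hwu huw⟩
  · rintro ⟨hw', hp, hneq, hmin⟩
    have hdrop : w'.dropLast = w := by
      obtain ⟨t, rfl⟩ := hp
      have ht : t ≠ [] := by rintro rfl; simp at hneq
      have hpre : w <+: (w ++ t).dropLast := by
        rw [List.dropLast_append_of_ne_nil ht]
        exact List.prefix_append _ _
      have hnil : (w ++ t).dropLast ≠ [] := fun h =>
        hne w hw.1 (List.prefix_nil.mp (h ▸ hpre))
      refine (hmin _ (hcl _ hw' _ (List.dropLast_prefix _) hnil) hpre
        (List.dropLast_prefix _)).resolve_right fun h => ?_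
      have hl := congrArg List.length h
      have := List.length_pos_iff.mpr ht
      simp only [List.length_dropLast, List.length_append] at hl
      omega
    exact ⟨⟨hw', by rwa [hdrop]⟩, hp, hneq, fun u hu => hmin u hu.1⟩

theorem isSTree_STree [Nonempty Act₂] (A : Arena Pos Act₁ Act₂ Prp)
    (σ : List Pos → Act₁) (v : Pos) : IsSTree (STree A Prod.fst σ v) := by
  refine ⟨?_, ?_, fun w hw w' => mem_STree_of_isPrefix hw, v, ?_⟩
  · obtain ⟨ρ, hc, h0⟩ := exists_consistPlay A σ v
    exact ⟨_, mem_STree.mpr ⟨ρ, hc, h0, 1, le_rfl, rfl⟩⟩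
  · rintro _ hw rfl
    obtain ⟨ρ, -, -, n, hn, he⟩ := mem_STree.mp hw
    have := congrArg List.length he
    rw [length_playPrefix, List.length_nil] at this
    omega
  · intro w hw
    obtain ⟨ρ, -, h0, n, hn, rfl⟩ := mem_STree.mp hw
    rw [head?_playPrefix ρ hn, h0]

theorem finite_cutAt_STree [Finite Pos] {A : Arena Pos Act₁ Act₂ Prp} {R : Set Pos}
    {σ : List Pos → Act₁} {v : Pos} [Nonempty Act₂] (h : WinningFrom A σ v R) :
    (cutAt R (STree A Prod.fst σ v)).Finite := by
  obtain ⟨⟨-, -, hcl, -⟩, -⟩ := treePrefix_cutAt (isSTree_STree A σ v) R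
  by_contra hinf
  obtain ⟨ρ, h0, hρ⟩ := exists_seq_playPrefix_mem (v := v) hcl (by
    intro w hw
    obtain ⟨ρ, -, h0, n, hn, rfl⟩ := mem_STree.mp hw.1
    rw [head?_playPrefix ρ hn, h0]) hinf
  have hc : ConsistPlay A Prod.fst σ ρ := by
    refine consistPlay_iff.mpr fun j => ?_
    obtain ⟨ρ', hc', -, n, -, he⟩ := mem_STree.mp (hρ (j + 1)).1
    have hn : j + 1 + 1 = n := by simpa using congrArg List.length he
    subst hn
    obtain ⟨a, ha⟩ := consistPlay_iff.mp hc' j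
    rw [playPrefix_succ, playPrefix_succ ρ'] at he
    obtain ⟨he', hlast⟩ := List.append_inj he (by simp)
    have hlast : ρ (j + 1) = ρ' (j + 1) := by simpa using hlast
    have hj : ρ j = ρ' j := by
      rw [playPrefix_succ, playPrefix_succ ρ'] at he'
      simpa using (List.append_inj he' (by simp)).2
    rw [he', hlast, hj]
    exact ⟨a, ha⟩
  obtain ⟨i, hi⟩ := h ρ hc.isPlay hc h0
  refine (hρ (i + 1)).2 (ρ i) ?_ hi
  rw [playPrefix_succ, List.dropLast_concat]
  exact mem_playPrefix.mpr ⟨i, by omega, rfl⟩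

theorem getLast?_mem_of_isLeafOf_cutAt {A : Arena Pos Act₁ Act₂ Prp} {R : Set Pos}
    {σ : List Pos → Act₁} {v : Pos} {w : List Pos}
    (hw : IsLeafOf (cutAt R (STree A Prod.fst σ v)) w) : ∃ p ∈ R, w.getLast? = some p := by
  obtain ⟨⟨hmem, hR⟩, hmax⟩ := hw
  obtain ⟨ρ, hc, h0, n, hn, rfl⟩ := mem_STree.mp hmem
  obtain ⟨m, rfl⟩ := Nat.exists_eq_add_of_le' hn
  refine ⟨ρ m, ?_, by simp [playPrefix_succ]⟩
  by_contra hm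
  have hnext : playPrefix ρ (m + 1 + 1) ∈ cutAt R (STree A Prod.fst σ v) := by
    refine ⟨mem_STree.mpr ⟨ρ, hc, h0, _, by omega, rfl⟩, ?_⟩
    rw [playPrefix_succ, List.dropLast_concat] at hR ⊢
    intro x hx
    rw [playPrefix_succ, List.mem_append, List.mem_singleton] at hx
    rcases hx with hx | rfl
    exacts [hR x hx, hm]
  have := hmax _ hnext ⟨[ρ (m + 1)], (playPrefix_succ ρ (m + 1)).symm⟩
  simpa using congrArg List.length this

theorem winning_iff_witness {Pos Act₁ Act₂ Prp : Type*}
    [Finite Pos] [Nonempty Pos] [Finite Act₁] [Nonempty Act₁] [Finite Act₂] [Nonempty Act₂]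
    (A : Arena Pos Act₁ Act₂ Prp) (R : Set Pos) (σ : List Pos → Act₁) (v : Pos) :
    WinningFrom A σ v R ↔ ∃ S : Set (List Pos), Witness A σ v R S := by
  constructor
  · intro h
    exact ⟨cutAt R (STree A Prod.fst σ v), finite_cutAt_STree h,
      treePrefix_cutAt (isSTree_STree A σ v) R, fun w => getLast?_mem_of_isLeafOf_cutAt⟩
  · rintro ⟨S, hfin, htree, hleaf⟩ ρ - hc h0
    have h1 : playPrefix ρ 1 ∈ S := by
      obtain ⟨-, ⟨a, haS, haT⟩, -⟩ := htree
      obtain ⟨ρ', -, h0', n, hn, he⟩ := mem_STree.mp haT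
      have := congrArg List.head? he
      rw [head?_playPrefix ρ' hn, h0'] at this
      obtain rfl : a = v := by simpa using this
      rwa [playPrefix_one, h0]
    obtain ⟨n, hn, hl⟩ := htree.exists_isLeafOf_playPrefix hfin
      (fun n hn => mem_STree.mpr ⟨ρ, hc, h0, n, hn, rfl⟩) h1
    obtain ⟨p, hp, hlast⟩ := hleaf _ hl
    obtain ⟨i, -, rfl⟩ := mem_playPrefix.mp (List.mem_of_getLast? hlast)
    exact ⟨i, hp⟩
end

section
/- Let T be an attack tree over Prop and (S, →, λ) a transition system. If a path π belongs to the path semantics [[T]] and π' is any path whose last state equals the first state of π, then the synchronized concatenation π' ⊙ π also belongs to [[T]]. (Adding an arbitrary prefix to an attack keeps it an attack.) -/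
variable {Pos Act₁ Act₂ Prp : Type*}

theorem ne_nil_of_mem_pathSem {σ π : Type*} {T : TSys σ π} {t : ATree σ} {w : List σ}
    (hw : w ∈ pathSem T t) : w ≠ [] := by
  induction t generalizing w with
  | leaf F => exact hw.1.1
  | or t₁ t₂ ih₁ ih₂ => exact hw.elim ih₁ ih₂
  | sand t₁ t₂ ih₁ _ =>
    obtain ⟨p, hp, q, -, -, rfl⟩ := hw
    exact List.append_ne_nil_of_left_ne_nil (ih₁ hp) _
  | and t₁ t₂ ih₁ ih₂ => exact hw.elim (fun h => ih₁ h.1) (fun h => ih₂ h.1)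

theorem getLast?_append_tail {α : Type*} {p p' : List α} (hp : p ≠ [])
    (hlink : p'.getLast? = p.head?) : (p' ++ p.tail).getLast? = p.getLast? := by
  obtain ⟨a, l, rfl⟩ := List.exists_cons_of_ne_nil hp
  cases l <;> simp_all [List.getLast?_append, List.getLast?_cons]

theorem IsTPath.append_tail {σ π : Type*} {T : TSys σ π} {p p' : List σ} (hp : IsTPath T p)
    (hp' : IsTPath T p') (hlink : p'.getLast? = p.head?) : IsTPath T (p' ++ p.tail) := by
  obtain ⟨hne, hc⟩ := hp
  obtain ⟨a, l, rfl⟩ := List.exists_cons_of_ne_nil hne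
  refine ⟨List.append_ne_nil_of_left_ne_nil hp'.1 _,
    List.IsChain.append hp'.2 hc.tail fun x hx y hy => ?_⟩
  obtain rfl : a = x := by simpa [hlink] using hx
  exact (List.isChain_cons.mp hc).1 y hy

theorem isPrefix_append_tail {α : Type*} {p q : List α} (hqp : q <+: p) (p' : List α) :
    p' ++ q.tail <+: p' ++ p.tail := by
  obtain ⟨r, rfl⟩ := hqp
  cases q <;> simp

theorem head?_eq_of_prefix_of_ne_nil {α : Type*} {p q : List α} (hq : q ≠ []) (hqp : q <+: p) :
    p.head? = q.head? := by
  obtain ⟨r, rfl⟩ := hqp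
  exact List.head?_append_of_ne_nil q hq

theorem pathSem_prefix_closed_left {σ π : Type*} [Finite σ] (T : TSys σ π) (t : ATree σ)
    (p p' : List σ) (hp : p ∈ pathSem T t) (hp' : IsTPath T p')
    (hlink : p'.getLast? = p.head?) :
    p' ++ p.tail ∈ pathSem T t := by
  induction t generalizing p p' with
  | leaf F =>
    obtain ⟨hpath, s, hs, hlast⟩ := hp
    exact ⟨hpath.append_tail hp' hlink, s, hs,
      (getLast?_append_tail hpath.1 hlink).trans hlast⟩
  | or t₁ t₂ ih₁ ih₂ =>
    exact hp.imp (fun h => ih₁ p p' h hp' hlink) (fun h => ih₂ p p' h hp' hlink)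
  | sand t₁ t₂ ih₁ _ =>
    obtain ⟨p₁, hp₁, q, hq, hpq, rfl⟩ := hp
    have hne := ne_nil_of_mem_pathSem hp₁
    have hlink₁ : p'.getLast? = p₁.head? :=
      hlink.trans (List.head?_append_of_ne_nil p₁ hne)
    refine ⟨p' ++ p₁.tail, ih₁ p₁ p' hp₁ hp' hlink₁, q, hq,
      (getLast?_append_tail hne hlink₁).trans hpq, ?_⟩
    rw [List.tail_append_of_ne_nil hne, List.append_assoc]
  | and t₁ t₂ ih₁ ih₂ =>
    refine hp.imp ?_ ?_
    · rintro ⟨h, q, hq, hqp⟩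
      exact ⟨ih₁ p p' h hp' hlink, p' ++ q.tail,
        ih₂ q p' hq hp' (hlink.trans (head?_eq_of_prefix_of_ne_nil (ne_nil_of_mem_pathSem hq) hqp)),
        isPrefix_append_tail hqp p'⟩
    · rintro ⟨h, q, hq, hqp⟩
      exact ⟨ih₂ p p' h hp' hlink, p' ++ q.tail,
        ih₁ q p' hq hp' (hlink.trans (head?_eq_of_prefix_of_ne_nil (ne_nil_of_mem_pathSem hq) hqp)),
        isPrefix_append_tail hqp p'⟩
end

section
/- The strategy semantics of attack trees is not compositional for the OR operator: there exist a two-player game arena A and two attack trees T₁ and T₂ such that [[T₁]]^strat = ∅ and [[T₂]]^strat = ∅, but [[OR(T₁, T₂)]]^strat ≠ ∅. (In particular, [[OR(T₁,T₂)]]^strat cannot be obtained as the union [[T₁]]^strat ∪ [[T₂]]^strat.) -/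
variable {Pos Act₁ Act₂ Prp : Type*}

theorem mem_childrenOf_iff {α : Type*} {S : Set (List α)}
    (hS : ∀ w ∈ S, ∀ w' : List α, w' <+: w → w' ≠ [] → w' ∈ S) {w w' : List α} :
    w' ∈ childrenOf S w ↔ w' ∈ S ∧ ∃ x, w' = w ++ [x] := by
  constructor
  · rintro ⟨h, ⟨t, rfl⟩, hne, hmin⟩
    refine ⟨h, ?_⟩
    cases t with
    | nil => simp at hne
    | cons x t =>
      have hp : w ++ [x] <+: w ++ x :: t := ⟨t, by simp⟩
      rcases hmin _ (hS _ h _ hp (by simp)) (List.prefix_append _ _) hp with h1 | h1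
      · simp at h1
      · exact ⟨x, h1.symm⟩
  · rintro ⟨h, x, rfl⟩
    refine ⟨h, List.prefix_append _ _, by simp, fun u _ h1 h2 => ?_⟩
    have l1 := h1.length_le
    have l2 := h2.length_le
    simp only [List.length_append, List.length_singleton] at l2
    rcases Nat.lt_or_ge w.length u.length with hl | hl
    · exact Or.inr (h2.eq_of_length (by simp; omega))
    · exact Or.inl (h1.eq_of_length (by omega)).symm

theorem exists_leaf_of_mem {α : Type*} {S : Set (List α)} (hS : S.Finite) {w : List α}
    (hw : w ∈ S) : ∃ u, IsLeafOf S u ∧ w <+: u := by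
  obtain ⟨u, ⟨hu, hwu⟩, hmax⟩ :=
    (hS.subset (Set.sep_subset S (w <+: ·))).exists_maximalFor List.length _ ⟨w, hw, List.prefix_rfl⟩
  refine ⟨u, ⟨hu, fun u' hu' h => ?_⟩, hwu⟩
  exact (h.eq_of_length (le_antisymm h.length_le
    (hmax ⟨hu', hwu.trans h⟩ h.length_le))).symm

theorem prefix_mem_hist (A : Arena Pos Act₁ Act₂ Prp) (v : Pos) :
    ∀ w ∈ Hist A v, ∀ w' : List Pos, w' <+: w → w' ≠ [] → w' ∈ Hist A v := by
  rintro _ ⟨ρ, hρ, h0, n, hn, rfl⟩ w' hp hne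
  refine ⟨ρ, hρ, h0, w'.length, List.length_pos_iff.2 hne, ?_⟩
  have hl := hp.length_le
  rw [List.prefix_iff_eq_take.1 hp]
  simp only [playPrefix, List.length_map, List.length_range] at hl ⊢
  simp [← List.map_take, List.take_range, hl]

theorem sTree_eq_hist [Subsingleton Act₁] (A : Arena Pos Act₁ Act₂ Prp)
    (σ : List Pos → Act₁) (v : Pos) : STree A Prod.fst σ v = Hist A v := by
  refine Set.Subset.antisymm Set.inter_subset_right ?_
  rintro w ⟨ρ, hρ, h0, n, hn, rfl⟩
  refine ⟨⟨ρ, hρ, fun m j hj => ?_, n, hn, rfl⟩, ρ, hρ, h0, n, hn, rfl⟩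
  obtain ⟨a, ha⟩ := hρ j
  exact ⟨a, by simp [playPrefix, ha], Subsingleton.elim _ _⟩

/-- From the position `none`, Defender picks a Boolean, which is then kept forever. -/
def choiceArena : Arena (Option Bool) Unit Bool Unit where
  delta p a := some (p.getD a.2)
  val _ := ∅

/-- Be at `none`, and later at `some b`. -/
def choiceTree (b : Bool) : ATree (Option Bool) :=
  .sand (.leaf {none}) (.leaf {some b})

theorem IsPlay.choice_succ {ρ : ℕ → Option Bool} (hρ : IsPlay choiceArena ρ) {c : Bool}
    (h1 : ρ 1 = some c) (k : ℕ) : ρ (k + 1) = some c := by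
  induction k with
  | zero => exact h1
  | succ k ih =>
    obtain ⟨a, ha⟩ := hρ (k + 1)
    simpa [choiceArena, ih] using ha

theorem pair_mem_hist_choice (c : Bool) : [none, some c] ∈ Hist choiceArena none := by
  refine ⟨fun k => k.casesOn none fun _ => some c, fun i => ⟨((), c), ?_⟩, rfl, 2, by simp, rfl⟩
  cases i <;> simp [choiceArena]

theorem of_mem_pathSem_choiceTree {b : Bool} {w : List (Option Bool)}
    (hw : w ∈ pathSem (arenaTS choiceArena) (choiceTree b)) :
    none ∈ w ∧ w.getLast? = some (some b) := by
  obtain ⟨p, ⟨-, _, rfl, hp⟩, q, ⟨⟨hq0, -⟩, _, rfl, hq⟩, hpq, rfl⟩ := hw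
  refine ⟨List.mem_append_left _ (List.mem_of_getLast? hp), ?_⟩
  rcases q with _ | ⟨x, _ | ⟨y, t⟩⟩
  · simp at hq
  · simp_all
  · simp_all [List.getLast?_append]

theorem pair_mem_pathSem_choiceTree (c : Bool) :
    [none, some c] ∈ pathSem (arenaTS choiceArena) (choiceTree c) := by
  refine ⟨[none], ⟨⟨by simp, List.isChain_singleton _⟩, none, rfl, rfl⟩, [none, some c],
    ⟨⟨by simp, List.isChain_pair.2 ⟨((), c), rfl⟩⟩, some c, rfl, rfl⟩, rfl, rfl⟩

theorem stratSem_choiceTree (b : Bool) : stratSem choiceArena (choiceTree b) = ∅ := by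
  refine Set.eq_empty_of_forall_notMem ?_
  rintro S ⟨⟨σ, v, -, -, hsub, hch⟩, hfin, ⟨⟨w, hw⟩, -, hpre, -⟩, hleaf⟩
  rw [sTree_eq_hist] at hsub
  simp only [sTree_eq_hist] at hch
  have hroot : v = none ∧ [none] ∈ S := by
    obtain ⟨u, hu, -⟩ := exists_leaf_of_mem hfin hw
    have hnone := (of_mem_pathSem_choiceTree (hleaf u hu)).1
    obtain ⟨ρ, hρ, h0, n, hn, rfl⟩ := hsub hu.1
    obtain ⟨k, -, hk⟩ := List.mem_map.1 hnone
    have hv : ρ 0 = none := by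
      cases k with
      | zero => exact hk
      | succ k =>
        obtain ⟨a, ha⟩ := hρ k
        simp [hk, choiceArena] at ha
    refine ⟨h0 ▸ hv, hpre _ hu.1 _ ?_ (by simp)⟩
    obtain ⟨m, rfl⟩ := Nat.exists_eq_succ_of_ne_zero (by omega : n ≠ 0)
    simp [playPrefix, List.range_succ_eq_map, hv]
  obtain ⟨rfl, hmem⟩ := hroot
  have hnl : ¬ IsLeafOf S [none] := fun h => by
    simpa using (of_mem_pathSem_choiceTree (hleaf _ h)).2
  have hpair : [none, some !b] ∈ S := by
    have h := (mem_childrenOf_iff (prefix_mem_hist choiceArena none)).2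
      ⟨pair_mem_hist_choice !b, some !b, (rfl : _ = [none] ++ _)⟩
    rw [← hch _ hmem hnl] at h
    exact h.1
  obtain ⟨u, hu, t, ht⟩ := exists_leaf_of_mem hfin hpair
  have hlast := (of_mem_pathSem_choiceTree (hleaf u hu)).2
  obtain ⟨ρ, hρ, h0, n, hn, hun⟩ := hsub hu.1
  have hlen : n = t.length + 2 := by
    simpa [playPrefix] using (congrArg List.length (ht.trans hun)).symm
  subst hlen
  have h1 : ρ 1 = some !b := by
    have := congrArg (·[1]?) (ht.trans hun)
    simpa [playPrefix] using this.symm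
  rw [hun, playPrefix, List.range_succ] at hlast
  simp [hρ.choice_succ h1] at hlast

theorem stratSem_or_choiceTree :
    ({[none], [none, some true], [none, some false]} : Set (List (Option Bool))) ∈
      stratSem choiceArena (.or (choiceTree true) (choiceTree false)) := by
  set S : Set (List (Option Bool)) := {[none], [none, some true], [none, some false]} with hS
  have hmemS (w) : w ∈ S ↔ w = [none] ∨ ∃ c, w = [none, some c] := by
    simp [hS, or_comm]
  have hpre : ∀ w ∈ S, ∀ w' : List (Option Bool), w' <+: w → w' ≠ [] → w' ∈ S := by
    intro w hw w' hp hne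
    rw [hmemS] at hw ⊢
    obtain rfl | ⟨c, rfl⟩ := hw
    · simp_all [List.prefix_cons_iff]
    · simp only [List.prefix_cons_iff, List.prefix_nil] at hp
      aesop
  have htree : IsSTree S := by
    refine ⟨⟨[none], by simp [hS]⟩, ?_, hpre, none, ?_⟩ <;> simp [hS]
  have hroot : [none] ∈ Hist choiceArena none :=
    prefix_mem_hist _ _ _ (pair_mem_hist_choice true) _ (by simp) (by simp)
  have hleaf (w) (hw : w ∈ S) : IsLeafOf S w ↔ w ≠ [none] := by
    constructor
    · rintro ⟨-, h⟩ rfl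
      simpa using h [none, some true] (by simp [hS]) (by simp)
    · intro hne
      refine ⟨hw, fun w' hw' hp => ?_⟩
      rw [hmemS] at hw hw'
      obtain ⟨c, rfl⟩ := hw.resolve_left hne
      obtain rfl | ⟨d, rfl⟩ := hw' <;> simp_all
  refine ⟨⟨fun _ => (), none, htree, ⟨none, by simp [hS], ?_⟩, ?_, ?_⟩, by simp [hS], htree, ?_⟩
  · rwa [sTree_eq_hist]
  · rw [sTree_eq_hist]
    intro w hw
    obtain rfl | ⟨c, rfl⟩ := (hmemS w).1 hw
    · exact hroot
    · exact pair_mem_hist_choice c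
  · intro w hw hnl
    obtain rfl : w = [none] := by simpa [hleaf w hw] using hnl
    ext w'
    rw [sTree_eq_hist, mem_childrenOf_iff hpre, mem_childrenOf_iff (prefix_mem_hist _ _)]
    refine and_congr_left ?_
    rintro ⟨x, rfl⟩
    constructor
    · intro h
      obtain h | ⟨c, h⟩ := (hmemS _).1 h
      · simp at h
      · exact h ▸ pair_mem_hist_choice c
    · rintro ⟨ρ, hρ, h0, n, hn, h⟩
      have hlen : n = 2 := by simpa [playPrefix] using (congrArg List.length h).symm
      subst hlen
      obtain ⟨a, ha⟩ := hρ 0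
      have hx : x = some a.2 := by
        have := congrArg (·[1]?) h
        simpa [playPrefix, ha, h0, choiceArena] using this
      exact (hmemS _).2 (Or.inr ⟨a.2, by simp [hx]⟩)
  · intro w hw
    obtain ⟨c, rfl⟩ := ((hmemS w).1 hw.1).resolve_left ((hleaf w hw.1).1 hw)
    cases c
    · exact Or.inr (pair_mem_pathSem_choiceTree false)
    · exact Or.inl (pair_mem_pathSem_choiceTree true)

theorem stratSem_not_compositional_or :
    ∃ (Pos Act₁ Act₂ Prp : Type) (_ : Fintype Pos) (_ : Nonempty Pos) (_ : Fintype Act₁)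
      (_ : Nonempty Act₁) (_ : Fintype Act₂) (_ : Nonempty Act₂)
      (A : Arena Pos Act₁ Act₂ Prp) (t₁ t₂ : ATree Pos),
      stratSem A t₁ = ∅ ∧ stratSem A t₂ = ∅ ∧ stratSem A (ATree.or t₁ t₂) ≠ ∅ :=
  ⟨Option Bool, Unit, Bool, Unit, inferInstance, inferInstance, inferInstance, inferInstance,
    inferInstance, inferInstance, choiceArena, choiceTree true, choiceTree false,
    stratSem_choiceTree true, stratSem_choiceTree false,
    Set.Nonempty.ne_empty ⟨_, stratSem_or_choiceTree⟩⟩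
end
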